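/- arXiv:quant-ph/0106042 — 8 statements merged into one kernel-verified Lean document; each statement's English description precedes it below -/
import Mathlib

section
/- Let S ⊆ ℝⁿ be a convex cone containing 0 (closed under nonnegative scalar multiplication and convex combinations), and let f : S → ℝ satisfy: (1) f(0) = 0; (2) f is monotone on S (x_i ≥ y_i for all i implies f(x) ≥ f(y) for x, y ∈ S); (3) f is concave on S. Then for all x, y ∈ S with x_i ≥ 0 and y_i > 0 for every i = 1, …, n, and with f(y) > 0, one has f(x)/f(y) ≥ min { min_i (x_i / y_i), 1 }. -/
/-- Theorem 2: the n-dimensional ratio bound for f-type functions on a convex cone. -/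
theorem ftype_ratio_bound
    {n : ℕ} (hn : 0 < n)
    (S : Set (Fin n → ℝ)) (hconv : Convex ℝ S) (h0S : (0 : Fin n → ℝ) ∈ S)
    (hcone : ∀ c : ℝ, 0 ≤ c → ∀ x ∈ S, c • x ∈ S)
    (f : (Fin n → ℝ) → ℝ)
    (hf0 : f 0 = 0)
    (hmono : ∀ x ∈ S, ∀ y ∈ S, (∀ i, y i ≤ x i) → f y ≤ f x)
    (hconc : ∀ x ∈ S, ∀ y ∈ S, ∀ p : ℝ, 0 ≤ p → p ≤ 1 →
      p * f x + (1 - p) * f y ≤ f (p • x + (1 - p) • y))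
    (x y : Fin n → ℝ) (hx : x ∈ S) (hy : y ∈ S)
    (hx0 : ∀ i, 0 ≤ x i) (hy0 : ∀ i, 0 < y i) (hfy : 0 < f y) :
    min (⨅ i, x i / y i) 1 ≤ f x / f y := by
  set c := min (⨅ i, x i / y i) 1
  have hc0 : 0 ≤ c :=
    le_min (Real.iInf_nonneg fun i => div_nonneg (hx0 i) (hy0 i).le) zero_le_one
  have hcy : ∀ i, (c • y) i ≤ x i := fun i =>
    (le_div_iff₀ (hy0 i)).1 <|
      (min_le_left _ _).trans (ciInf_le (Set.finite_range fun i => x i / y i).bddBelow i)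
  have hscale : c * f y ≤ f (c • y) := by
    simpa [hf0] using hconc y hy 0 h0S c hc0 (min_le_right _ _)
  exact (le_div_iff₀ hfy).2 (hscale.trans (hmono x hx (c • y) (hcone c hc0 y hy) hcy))
end

section
/- Let t : Fin 2 → Fin 2 → Fin 2 → ℂ be the coefficient tensor of a three-qubit state, let n ≥ 1, and let σ, τ be permutations of {1, …, n}. Let U, V, W be 2×2 unitary complex matrices and define t'_{ijk} = Σ_{i',j',k'} U_{i i'} V_{j j'} W_{k k'} t_{i' j' k'}. Then P_{σ,τ}(t') = P_{σ,τ}(t). -/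
open scoped BigOperators

/-- The polynomial invariant `P_{σ,τ}` of a three-qubit coefficient tensor. -/
noncomputable def polyInv {n : ℕ} (σ τ : Equiv.Perm (Fin n))
    (t : Fin 2 → Fin 2 → Fin 2 → ℂ) : ℂ :=
  ∑ i : Fin n → Fin 2, ∑ j : Fin n → Fin 2, ∑ k : Fin n → Fin 2,
    (∏ m : Fin n, t (i m) (j m) (k m)) *
      (∏ m : Fin n, (starRingEnd ℂ) (t (i m) (j (σ m)) (k (τ m))))

open Matrix in
/-- Unitary matrices preserve the Hermitian inner product. -/
theorem sum_mulVec_mul_conj_mulVec {κ : Type*} [Fintype κ] [DecidableEq κ]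
    {U : Matrix κ κ ℂ} (hU : U ∈ Matrix.unitaryGroup κ ℂ) (f g : κ → ℂ) :
    ∑ a, (U *ᵥ f) a * (starRingEnd ℂ) ((U *ᵥ g) a) = ∑ a, f a * (starRingEnd ℂ) (g a) := by
  change (U *ᵥ f) ⬝ᵥ star (U *ᵥ g) = f ⬝ᵥ star g
  have hU' : Uᴴ * U = 1 := Matrix.mem_unitaryGroup_iff'.mp hU
  rw [dotProduct_comm, star_mulVec, ← dotProduct_mulVec, mulVec_mulVec, hU', one_mulVec,
    dotProduct_comm]

/-- A permuted contraction of two families of vectors factors into inner products. -/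
theorem sum_prod_mul_prod_conj_perm {ι κ : Type*} [Fintype ι] [DecidableEq ι] [Fintype κ]
    (σ : Equiv.Perm ι) (f g : ι → κ → ℂ) :
    ∑ i : ι → κ, (∏ m, f m (i m)) * ∏ m, (starRingEnd ℂ) (g m (i (σ m))) =
      ∏ m, ∑ a, f m a * (starRingEnd ℂ) (g (σ.symm m) a) := by
  rw [Finset.prod_univ_sum, Fintype.piFinset_univ]
  refine Finset.sum_congr rfl fun i _ => ?_
  rw [Finset.prod_mul_distrib,
    ← Equiv.prod_comp σ fun m => (starRingEnd ℂ) (g (σ.symm m) (i m))]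
  simp only [Equiv.symm_apply_apply]

open Matrix in
/-- Permuted contractions are unchanged when all vectors are moved by the same unitary. -/
theorem sum_prod_mulVec_mul_prod_conj_mulVec_perm {ι κ : Type*} [Fintype ι] [DecidableEq ι]
    [Fintype κ] [DecidableEq κ] {U : Matrix κ κ ℂ} (hU : U ∈ Matrix.unitaryGroup κ ℂ)
    (σ : Equiv.Perm ι) (f g : ι → κ → ℂ) :
    ∑ i : ι → κ, (∏ m, (U *ᵥ f m) (i m)) * ∏ m, (starRingEnd ℂ) ((U *ᵥ g m) (i (σ m))) =
      ∑ i : ι → κ, (∏ m, f m (i m)) * ∏ m, (starRingEnd ℂ) (g m (i (σ m))) := by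
  rw [sum_prod_mul_prod_conj_perm σ (fun m => U *ᵥ f m) (fun m => U *ᵥ g m),
    sum_prod_mul_prod_conj_perm]
  simp only [sum_mulVec_mul_conj_mulVec hU]

open Matrix in
theorem polyInv_mulVec_fst {n : ℕ} (σ τ : Equiv.Perm (Fin n)) (t : Fin 2 → Fin 2 → Fin 2 → ℂ)
    {U : Matrix (Fin 2) (Fin 2) ℂ} (hU : U ∈ Matrix.unitaryGroup (Fin 2) ℂ) :
    polyInv σ τ (fun i j k => (U *ᵥ fun a => t a j k) i) = polyInv σ τ t := by
  have push_in (F : (Fin n → Fin 2) → (Fin n → Fin 2) → (Fin n → Fin 2) → ℂ) :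
      ∑ i, ∑ j, ∑ k, F i j k = ∑ j, ∑ k, ∑ i, F i j k := by
    rw [Finset.sum_comm]
    exact Finset.sum_congr rfl fun j _ => Finset.sum_comm
  unfold polyInv
  refine (push_in _).trans (Eq.trans ?_ (push_in _).symm)
  refine Finset.sum_congr rfl fun j _ => Finset.sum_congr rfl fun k _ => ?_
  exact sum_prod_mulVec_mul_prod_conj_mulVec_perm hU 1
    (fun m a => t a (j m) (k m)) (fun m a => t a (j (σ m)) (k (τ m)))

open Matrix in
theorem polyInv_mulVec_snd {n : ℕ} (σ τ : Equiv.Perm (Fin n)) (t : Fin 2 → Fin 2 → Fin 2 → ℂ)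
    {V : Matrix (Fin 2) (Fin 2) ℂ} (hV : V ∈ Matrix.unitaryGroup (Fin 2) ℂ) :
    polyInv σ τ (fun i j k => (V *ᵥ fun b => t i b k) j) = polyInv σ τ t := by
  unfold polyInv
  refine Finset.sum_congr rfl fun i _ => ?_
  refine Finset.sum_comm.trans (Eq.trans ?_ Finset.sum_comm)
  refine Finset.sum_congr rfl fun k _ => ?_
  exact sum_prod_mulVec_mul_prod_conj_mulVec_perm hV σ
    (fun m b => t (i m) b (k m)) (fun m b => t (i m) b (k (τ m)))

open Matrix in
theorem polyInv_mulVec_trd {n : ℕ} (σ τ : Equiv.Perm (Fin n)) (t : Fin 2 → Fin 2 → Fin 2 → ℂ)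
    {W : Matrix (Fin 2) (Fin 2) ℂ} (hW : W ∈ Matrix.unitaryGroup (Fin 2) ℂ) :
    polyInv σ τ (fun i j k => (W *ᵥ t i j) k) = polyInv σ τ t := by
  unfold polyInv
  refine Finset.sum_congr rfl fun i _ => Finset.sum_congr rfl fun j _ => ?_
  exact sum_prod_mulVec_mul_prod_conj_mulVec_perm hW τ
    (fun m => t (i m) (j m)) (fun m => t (i m) (j (σ m)))

/-- Every polynomial invariant `P_{σ,τ}` is invariant under local unitary
transformations of the three qubits. -/
theorem polyInv_local_unitary_invariant
    {n : ℕ} (hn : 1 ≤ n) (σ τ : Equiv.Perm (Fin n))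
    (t t' : Fin 2 → Fin 2 → Fin 2 → ℂ)
    (U V W : Matrix (Fin 2) (Fin 2) ℂ)
    (hU : U ∈ Matrix.unitaryGroup (Fin 2) ℂ)
    (hV : V ∈ Matrix.unitaryGroup (Fin 2) ℂ)
    (hW : W ∈ Matrix.unitaryGroup (Fin 2) ℂ)
    (ht' : ∀ i j k, t' i j k =
      ∑ i' : Fin 2, ∑ j' : Fin 2, ∑ k' : Fin 2,
        U i i' * V j j' * W k k' * t i' j' k') :
    polyInv σ τ t' = polyInv σ τ t := by
  have ht : t' = fun i j k => U.mulVec (fun a => V.mulVec (fun b => W.mulVec (t a b) k) j) i := by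
    ext i j k
    simp only [ht', Matrix.mulVec, dotProduct, Finset.mul_sum, mul_assoc]
  rw [ht]
  exact (polyInv_mulVec_fst σ τ (fun a j k => V.mulVec (fun b => W.mulVec (t a b) k) j) hU).trans
    ((polyInv_mulVec_snd σ τ (fun a b k => W.mulVec (t a b) k) hV).trans
      (polyInv_mulVec_trd σ τ t hW))
end

section
/- Let μ₀, μ₁, μ₂, μ₃, μ₄ ≥ 0 with μ₀+μ₁+μ₂+μ₃+μ₄ = 1 and φ ∈ ℝ, and let t be the coefficient tensor of the diagonalization-decomposition state. Set Δ = μ₁μ₄ + μ₂μ₃ − 2√(μ₁μ₂μ₃μ₄)·cos φ. Then I₁(t) = 1 − 2μ₀(μ₂+μ₄) − 2Δ, I₂(t) = 1 − 2μ₀(μ₃+μ₄) − 2Δ, and I₃(t) = 1 − 2μ₀(μ₂+μ₃+μ₄). -/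
open scoped BigOperators

/-- `I₁(t) = Σ t_{i₁j₁k₁} t_{i₂j₂k₂} conj(t_{i₁j₁k₂}) conj(t_{i₂j₂k₁})`. -/
noncomputable def I₁ (t : Fin 2 → Fin 2 → Fin 2 → ℂ) : ℂ :=
  ∑ i₁ : Fin 2, ∑ i₂ : Fin 2, ∑ j₁ : Fin 2, ∑ j₂ : Fin 2, ∑ k₁ : Fin 2, ∑ k₂ : Fin 2,
    t i₁ j₁ k₁ * t i₂ j₂ k₂ * (starRingEnd ℂ) (t i₁ j₁ k₂) * (starRingEnd ℂ) (t i₂ j₂ k₁)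

/-- `I₂(t) = Σ t_{i₁j₁k₁} t_{i₂j₂k₂} conj(t_{i₁j₂k₁}) conj(t_{i₂j₁k₂})`. -/
noncomputable def I₂ (t : Fin 2 → Fin 2 → Fin 2 → ℂ) : ℂ :=
  ∑ i₁ : Fin 2, ∑ i₂ : Fin 2, ∑ j₁ : Fin 2, ∑ j₂ : Fin 2, ∑ k₁ : Fin 2, ∑ k₂ : Fin 2,
    t i₁ j₁ k₁ * t i₂ j₂ k₂ * (starRingEnd ℂ) (t i₁ j₂ k₁) * (starRingEnd ℂ) (t i₂ j₁ k₂)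

/-- `I₃(t) = Σ t_{i₁j₁k₁} t_{i₂j₂k₂} conj(t_{i₁j₂k₂}) conj(t_{i₂j₁k₁})`. -/
noncomputable def I₃ (t : Fin 2 → Fin 2 → Fin 2 → ℂ) : ℂ :=
  ∑ i₁ : Fin 2, ∑ i₂ : Fin 2, ∑ j₁ : Fin 2, ∑ j₂ : Fin 2, ∑ k₁ : Fin 2, ∑ k₂ : Fin 2,
    t i₁ j₁ k₁ * t i₂ j₂ k₂ * (starRingEnd ℂ) (t i₁ j₂ k₂) * (starRingEnd ℂ) (t i₂ j₁ k₁)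
/-- The coefficient tensor of the diagonalization-decomposition (DD) state
`√μ₀|000⟩ + √μ₁ e^{iφ}|100⟩ + √μ₂|101⟩ + √μ₃|110⟩ + √μ₄|111⟩`. -/
noncomputable def ddTensor (μ₀ μ₁ μ₂ μ₃ μ₄ φ : ℝ) : Fin 2 → Fin 2 → Fin 2 → ℂ :=
  fun i j k =>
    if i = 0 ∧ j = 0 ∧ k = 0 then (Real.sqrt μ₀ : ℂ)
    else if i = 1 ∧ j = 0 ∧ k = 0 then (Real.sqrt μ₁ : ℂ) * Complex.exp (Complex.I * (φ : ℂ))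
    else if i = 1 ∧ j = 0 ∧ k = 1 then (Real.sqrt μ₂ : ℂ)
    else if i = 1 ∧ j = 1 ∧ k = 0 then (Real.sqrt μ₃ : ℂ)
    else if i = 1 ∧ j = 1 ∧ k = 1 then (Real.sqrt μ₄ : ℂ)
    else 0

/-- The invariants `I₁, I₂, I₃` of the DD state in terms of the DD parameters. -/
theorem I₁_I₂_I₃_ddTensor (μ₀ μ₁ μ₂ μ₃ μ₄ φ : ℝ)
    (h₀ : 0 ≤ μ₀) (h₁ : 0 ≤ μ₁) (h₂ : 0 ≤ μ₂) (h₃ : 0 ≤ μ₃) (h₄ : 0 ≤ μ₄)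
    (hsum : μ₀ + μ₁ + μ₂ + μ₃ + μ₄ = 1)
    (Δ : ℝ) (hΔ : Δ = μ₁ * μ₄ + μ₂ * μ₃ - 2 * Real.sqrt (μ₁ * μ₂ * μ₃ * μ₄) * Real.cos φ) :
    I₁ (ddTensor μ₀ μ₁ μ₂ μ₃ μ₄ φ) = ((1 - 2 * μ₀ * (μ₂ + μ₄) - 2 * Δ : ℝ) : ℂ) ∧
    I₂ (ddTensor μ₀ μ₁ μ₂ μ₃ μ₄ φ) = ((1 - 2 * μ₀ * (μ₃ + μ₄) - 2 * Δ : ℝ) : ℂ) ∧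
    I₃ (ddTensor μ₀ μ₁ μ₂ μ₃ μ₄ φ) = ((1 - 2 * μ₀ * (μ₂ + μ₃ + μ₄) : ℝ) : ℂ) := by
  have e₁ : Complex.exp (Complex.I * φ) * (starRingEnd ℂ) (Complex.exp (Complex.I * φ)) = 1 := by
    rw [← Complex.exp_conj, ← Complex.exp_add]
    simp
  have e₂ : Complex.exp (Complex.I * φ) + (starRingEnd ℂ) (Complex.exp (Complex.I * φ)) =
      2 * (Real.cos φ : ℂ) := by
    rw [← Complex.exp_conj, Complex.ofReal_cos, Complex.two_cos]
    simp [mul_comm]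
  have exists_sq {x : ℝ} (hx : 0 ≤ x) : ∃ y, 0 ≤ y ∧ y ^ 2 = x :=
    ⟨√x, Real.sqrt_nonneg x, Real.sq_sqrt hx⟩
  obtain ⟨a, ha, rfl⟩ := exists_sq h₀
  obtain ⟨b, hb, rfl⟩ := exists_sq h₁
  obtain ⟨c, hc, rfl⟩ := exists_sq h₂
  obtain ⟨d, hd, rfl⟩ := exists_sq h₃
  obtain ⟨f, hf, rfl⟩ := exists_sq h₄
  rw [show b ^ 2 * c ^ 2 * d ^ 2 * f ^ 2 = (b * c * d * f) ^ 2 by ring,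
    Real.sqrt_sq (by positivity)] at hΔ
  subst hΔ
  have hsum' : (a ^ 2 + b ^ 2 + c ^ 2 + d ^ 2 + f ^ 2 : ℂ) = 1 := mod_cast hsum
  refine ⟨?_, ?_, ?_⟩ <;>
    simp only [I₁, I₂, I₃, ddTensor, Fin.sum_univ_two, Fin.isValue, zero_ne_one, one_ne_zero,
      and_true, and_false, if_true, if_false, map_mul, map_zero, Complex.conj_ofReal,
      mul_zero, zero_mul, add_zero, Real.sqrt_sq, ha, hb, hc, hd, hf] <;>
    generalize (starRingEnd ℂ) (Complex.exp (Complex.I * φ)) = e' at * <;>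
    generalize Complex.exp (Complex.I * φ) = e at * <;>
    push_cast at e₂ ⊢
  · linear_combination (b ^ 2 * (2 * (a ^ 2 + c ^ 2 + d ^ 2 + f ^ 2) + b ^ 2 * (e * e' + 1)) -
      2 * b ^ 2 * f ^ 2) * e₁ +
      2 * b * c * d * f * e₂ + (a ^ 2 + b ^ 2 + c ^ 2 + d ^ 2 + f ^ 2 + 1) * hsum'
  · linear_combination (b ^ 2 * (2 * (a ^ 2 + c ^ 2 + d ^ 2 + f ^ 2) + b ^ 2 * (e * e' + 1)) -
      2 * b ^ 2 * f ^ 2) * e₁ +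
      2 * b * c * d * f * e₂ + (a ^ 2 + b ^ 2 + c ^ 2 + d ^ 2 + f ^ 2 + 1) * hsum'
  · linear_combination b ^ 2 * (2 * (a ^ 2 + c ^ 2 + d ^ 2 + f ^ 2) + b ^ 2 * (e * e' + 1)) * e₁ +
      (a ^ 2 + b ^ 2 + c ^ 2 + d ^ 2 + f ^ 2 + 1) * hsum'
end

section
/- Let μ₀, μ₁, μ₂, μ₃, μ₄ ≥ 0 with μ₀+μ₁+μ₂+μ₃+μ₄ = 1 and φ ∈ ℝ, and let t be the coefficient tensor of the diagonalization-decomposition state. Set Δ = μ₁μ₄ + μ₂μ₃ − 2√(μ₁μ₂μ₃μ₄)·cos φ. Then I₄(t) = 1 − 3·[ (μ₂+μ₃)(μ₀−μ₄) + μ₄(1−μ₄) − μ₂μ₃μ₀ + (1−μ₀)(Δ − μ₁μ₄) ]. -/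
open scoped BigOperators

/-- The Kempe invariant
`I₄(t) = Σ t_{i₁j₁k₁} t_{i₂j₂k₂} t_{i₃j₃k₃} conj(t_{i₁j₂k₃}) conj(t_{i₂j₃k₁}) conj(t_{i₃j₁k₂})`. -/
noncomputable def I₄ (t : Fin 2 → Fin 2 → Fin 2 → ℂ) : ℂ :=
  ∑ i₁ : Fin 2, ∑ i₂ : Fin 2, ∑ i₃ : Fin 2,
    ∑ j₁ : Fin 2, ∑ j₂ : Fin 2, ∑ j₃ : Fin 2,
      ∑ k₁ : Fin 2, ∑ k₂ : Fin 2, ∑ k₃ : Fin 2,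
        t i₁ j₁ k₁ * t i₂ j₂ k₂ * t i₃ j₃ k₃ *
          (starRingEnd ℂ) (t i₁ j₂ k₃) * (starRingEnd ℂ) (t i₂ j₃ k₁) *
            (starRingEnd ℂ) (t i₃ j₁ k₂)
/-- The Kempe invariant `I₄` of the DD state in terms of the DD parameters. -/
theorem I₄_ddTensor (μ₀ μ₁ μ₂ μ₃ μ₄ φ : ℝ)
    (h₀ : 0 ≤ μ₀) (h₁ : 0 ≤ μ₁) (h₂ : 0 ≤ μ₂) (h₃ : 0 ≤ μ₃) (h₄ : 0 ≤ μ₄)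
    (hsum : μ₀ + μ₁ + μ₂ + μ₃ + μ₄ = 1)
    (Δ : ℝ) (hΔ : Δ = μ₁ * μ₄ + μ₂ * μ₃ - 2 * Real.sqrt (μ₁ * μ₂ * μ₃ * μ₄) * Real.cos φ) :
    I₄ (ddTensor μ₀ μ₁ μ₂ μ₃ μ₄ φ) =
      ((1 - 3 * ((μ₂ + μ₃) * (μ₀ - μ₄) + μ₄ * (1 - μ₄) - μ₂ * μ₃ * μ₀ +
        (1 - μ₀) * (Δ - μ₁ * μ₄)) : ℝ) : ℂ) := by
  have hcos : 2 * (Real.cos φ : ℂ) =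
      Complex.exp (Complex.I * φ) + Complex.exp (-(Complex.I * φ)) := by
    rw [Complex.ofReal_cos, Complex.two_cos, mul_comm Complex.I, neg_mul]
  have hexp : Complex.exp (Complex.I * φ) * Complex.exp (-(Complex.I * φ)) = 1 := by
    rw [← Complex.exp_add, add_neg_cancel, Complex.exp_zero]
  have hconj : (starRingEnd ℂ) (Complex.exp (Complex.I * φ)) =
      Complex.exp (-(Complex.I * φ)) := by
    simp [← Complex.exp_conj]
  rw [Real.sqrt_mul (by positivity), Real.sqrt_mul (by positivity), Real.sqrt_mul h₁] at hΔ
  have hμ₀ := Real.sq_sqrt h₀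
  have hμ₁ := Real.sq_sqrt h₁
  have hμ₂ := Real.sq_sqrt h₂
  have hμ₃ := Real.sq_sqrt h₃
  have hμ₄ := Real.sq_sqrt h₄
  simp only [I₄, ddTensor, Fin.sum_univ_two]
  generalize √μ₀ = a at *
  generalize √μ₁ = b at *
  generalize √μ₂ = c at *
  generalize √μ₃ = d at *
  generalize √μ₄ = f at *
  subst hμ₀ hμ₁ hμ₂ hμ₃ hμ₄ hΔ
  have hnorm : (a : ℂ) ^ 2 + b ^ 2 + c ^ 2 + d ^ 2 + f ^ 2 = 1 := by exact_mod_cast hsum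
  simp only [Fin.isValue, zero_ne_one, one_ne_zero, and_true, and_false, and_self,
    if_true, if_false, map_mul, map_zero, Complex.conj_ofReal, hconj, mul_zero,
    zero_mul, add_zero]
  generalize Complex.exp (Complex.I * φ) = u at *
  generalize Complex.exp (-(Complex.I * φ)) = v at *
  push_cast [-Complex.ofReal_cos]
  linear_combination
    (3 * a ^ 4 * b ^ 2 + 3 * a ^ 2 * b ^ 4 * (u * v + 1) + 3 * a ^ 2 * b ^ 2 * (c ^ 2 + d ^ 2)
      + 3 * b ^ 4 * (c ^ 2 + d ^ 2) * (u * v + 1)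
      + 3 * b ^ 2 * (c ^ 4 + d ^ 4 + c ^ 2 * d ^ 2 + c ^ 2 * f ^ 2 + d ^ 2 * f ^ 2)
      + 3 * b ^ 3 * c * d * f * (u + v) + b ^ 6 * ((u * v) ^ 2 + u * v + 1)) * hexp
    + ((a ^ 2 + b ^ 2 + c ^ 2 + d ^ 2 + f ^ 2) ^ 2 + (a ^ 2 + b ^ 2 + c ^ 2 + d ^ 2 + f ^ 2) + 1
      - 3 * ((c ^ 2 + d ^ 2) * (a ^ 2 - f ^ 2)
        + f ^ 2 * (a ^ 2 + b ^ 2 + c ^ 2 + d ^ 2 + f ^ 2 + 1) - f ^ 4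
        + c ^ 2 * d ^ 2 - b * c * d * f * (u + v))) * hnorm
    - 3 * (1 - a ^ 2) * b * c * d * f * hcos
end

section
/- Let a, b, c, d, f ≥ 0 with a²+b²+c²+d²+f² = 1 and φ ∈ ℝ, and let t be the coefficient tensor of the maximization-decomposition state. Then I₁(t) = 1 − 2·((a²+d²)(b²+c²) + a²f²), I₂(t) = 1 − 2·((a²+c²)(b²+d²) + a²f²), and I₃(t) = 1 − 2·((a²+b²)(c²+d²) + a²f²). -/
open scoped BigOperators

/-- The coefficient tensor of the maximization-decomposition (MD) state
`a e^{iφ}|000⟩ + b|011⟩ + c|101⟩ + d|110⟩ + f|111⟩`. -/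
noncomputable def mdTensor (a b c d f φ : ℝ) : Fin 2 → Fin 2 → Fin 2 → ℂ :=
  fun i j k =>
    if i = 0 ∧ j = 0 ∧ k = 0 then (a : ℂ) * Complex.exp (Complex.I * (φ : ℂ))
    else if i = 0 ∧ j = 1 ∧ k = 1 then (b : ℂ)
    else if i = 1 ∧ j = 0 ∧ k = 1 then (c : ℂ)
    else if i = 1 ∧ j = 1 ∧ k = 0 then (d : ℂ)
    else if i = 1 ∧ j = 1 ∧ k = 1 then (f : ℂ)
    else 0

/-- The invariants `I₁, I₂, I₃` of the MD state in terms of the MD parameters. -/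
theorem I₁_I₂_I₃_mdTensor (a b c d f φ : ℝ)
    (ha : 0 ≤ a) (hb : 0 ≤ b) (hc : 0 ≤ c) (hd : 0 ≤ d) (hf : 0 ≤ f)
    (hsum : a ^ 2 + b ^ 2 + c ^ 2 + d ^ 2 + f ^ 2 = 1) :
    I₁ (mdTensor a b c d f φ) =
      ((1 - 2 * ((a ^ 2 + d ^ 2) * (b ^ 2 + c ^ 2) + a ^ 2 * f ^ 2) : ℝ) : ℂ) ∧
    I₂ (mdTensor a b c d f φ) =
      ((1 - 2 * ((a ^ 2 + c ^ 2) * (b ^ 2 + d ^ 2) + a ^ 2 * f ^ 2) : ℝ) : ℂ) ∧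
    I₃ (mdTensor a b c d f φ) =
      ((1 - 2 * ((a ^ 2 + b ^ 2) * (c ^ 2 + d ^ 2) + a ^ 2 * f ^ 2) : ℝ) : ℂ) := by
  have hs : (a : ℂ) ^ 2 + (b : ℂ) ^ 2 + (c : ℂ) ^ 2 + (d : ℂ) ^ 2 + (f : ℂ) ^ 2 = 1 := by
    exact_mod_cast hsum
  have hw : Complex.exp (Complex.I * (φ : ℂ)) *
      (starRingEnd ℂ) (Complex.exp (Complex.I * (φ : ℂ))) = 1 := by
    rw [Complex.mul_conj, Complex.normSq_eq_norm_sq, Complex.norm_exp_I_mul_ofReal]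
    norm_num
  unfold I₁ I₂ I₃ mdTensor
  generalize Complex.exp (Complex.I * (φ : ℂ)) = w at hw ⊢
  refine ⟨?_, ?_, ?_⟩ <;>
    simp only [Fin.sum_univ_two, Fin.isValue, zero_ne_one, one_ne_zero, and_true, and_false,
      if_true, if_false, map_mul, map_zero, Complex.conj_ofReal, mul_zero, zero_mul,
      add_zero, zero_add] <;>
    push_cast
  · linear_combination
      ((a : ℂ) ^ 4 * (w * (starRingEnd ℂ) w + 1) + 2 * (a : ℂ) ^ 2 * (d : ℂ) ^ 2) * hw +
      ((a : ℂ) ^ 2 + (b : ℂ) ^ 2 + (c : ℂ) ^ 2 + (d : ℂ) ^ 2 + (f : ℂ) ^ 2 + 1) * hs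
  · linear_combination
      ((a : ℂ) ^ 4 * (w * (starRingEnd ℂ) w + 1) + 2 * (a : ℂ) ^ 2 * (c : ℂ) ^ 2) * hw +
      ((a : ℂ) ^ 2 + (b : ℂ) ^ 2 + (c : ℂ) ^ 2 + (d : ℂ) ^ 2 + (f : ℂ) ^ 2 + 1) * hs
  · linear_combination
      ((a : ℂ) ^ 4 * (w * (starRingEnd ℂ) w + 1) + 2 * (a : ℂ) ^ 2 * (b : ℂ) ^ 2) * hw +
      ((a : ℂ) ^ 2 + (b : ℂ) ^ 2 + (c : ℂ) ^ 2 + (d : ℂ) ^ 2 + (f : ℂ) ^ 2 + 1) * hs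
end

section
/- Let t : Fin 2 → Fin 2 → Fin 2 → ℂ be a three-qubit coefficient tensor and let π be any permutation of the three tensor factors (i.e. t^π is obtained from t by permuting the roles of the three indices according to π). Then I₄(t^π) = I₄(t). -/
open scoped BigOperators

/-- The tensor obtained from `t` by permuting the roles of the three indices
according to the permutation `π` of the three tensor factors. -/
def permTensor (π : Equiv.Perm (Fin 3)) (t : Fin 2 → Fin 2 → Fin 2 → ℂ) :
    Fin 2 → Fin 2 → Fin 2 → ℂ :=
  fun i j k => t (![i, j, k] (π 0)) (![i, j, k] (π 1)) (![i, j, k] (π 2))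

/-- Exchanging the first two particles leaves the Kempe invariant unchanged. -/
theorem I₄_swap_left (t : Fin 2 → Fin 2 → Fin 2 → ℂ) :
    I₄ (fun i j k => t j i k) = I₄ t := by
  simp only [I₄, ← Fintype.sum_prod_type']
  refine Fintype.sum_equiv
    { toFun := fun (i₁, i₂, i₃, j₁, j₂, j₃, k₁, k₂, k₃) =>
        (j₁, j₃, j₂, i₁, i₃, i₂, k₁, k₃, k₂)
      invFun := fun (i₁, i₂, i₃, j₁, j₂, j₃, k₁, k₂, k₃) =>
        (j₁, j₃, j₂, i₁, i₃, i₂, k₁, k₃, k₂)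
      left_inv := fun _ => rfl
      right_inv := fun _ => rfl } _ _ fun _ => ?_
  dsimp only [Equiv.coe_fn_mk]
  ring

/-- Exchanging the last two particles leaves the Kempe invariant unchanged. -/
theorem I₄_swap_right (t : Fin 2 → Fin 2 → Fin 2 → ℂ) :
    I₄ (fun i j k => t i k j) = I₄ t := by
  simp only [I₄, ← Fintype.sum_prod_type']
  refine Fintype.sum_equiv
    { toFun := fun (i₁, i₂, i₃, j₁, j₂, j₃, k₁, k₂, k₃) =>
        (i₁, i₃, i₂, k₁, k₃, k₂, j₁, j₃, j₂)
      invFun := fun (i₁, i₂, i₃, j₁, j₂, j₃, k₁, k₂, k₃) =>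
        (i₁, i₃, i₂, k₁, k₃, k₂, j₁, j₃, j₂)
      left_inv := fun _ => rfl
      right_inv := fun _ => rfl } _ _ fun _ => ?_
  dsimp only [Equiv.coe_fn_mk]
  ring

/-- The Kempe invariant `I₄` is symmetric under any permutation of the three particles. -/
theorem I₄_perm_invariant (t : Fin 2 → Fin 2 → Fin 2 → ℂ) (π : Equiv.Perm (Fin 3)) :
    I₄ (permTensor π t) = I₄ t := by
  have values : ∀ σ : Equiv.Perm (Fin 3),
      (σ 0 = 0 ∧ σ 1 = 1 ∧ σ 2 = 2) ∨ (σ 0 = 1 ∧ σ 1 = 0 ∧ σ 2 = 2) ∨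
      (σ 0 = 0 ∧ σ 1 = 2 ∧ σ 2 = 1) ∨ (σ 0 = 1 ∧ σ 1 = 2 ∧ σ 2 = 0) ∨
      (σ 0 = 2 ∧ σ 1 = 0 ∧ σ 2 = 1) ∨ (σ 0 = 2 ∧ σ 1 = 1 ∧ σ 2 = 0) := by
    decide
  unfold permTensor
  rcases values π with ⟨h₀, h₁, h₂⟩ | ⟨h₀, h₁, h₂⟩ | ⟨h₀, h₁, h₂⟩ | ⟨h₀, h₁, h₂⟩ |
    ⟨h₀, h₁, h₂⟩ | ⟨h₀, h₁, h₂⟩ <;> rw [h₀, h₁, h₂]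
  · rfl
  · exact I₄_swap_left t
  · exact I₄_swap_right t
  · exact (I₄_swap_left fun i j k => t i k j).trans (I₄_swap_right t)
  · exact (I₄_swap_right fun i j k => t j i k).trans (I₄_swap_left t)
  · exact (I₄_swap_left fun i j k => t k i j).trans
      ((I₄_swap_right fun i j k => t j i k).trans (I₄_swap_left t))
end

section
/- Let t : Fin 2 → Fin 2 → Fin 2 → ℂ be the coefficient tensor of a three-qubit unit vector ψ = Σ t_{ijk}|ijk⟩ (so Σ |t_{ijk}|² = 1). Suppose that for all unit vectors α, β, γ ∈ ℂ², |⟨ψ, α⊗β⊗γ⟩|² ≤ |t_{000}|², i.e. the product state |000⟩ maximizes the overlap g(α,β,γ) = |⟨ψ, α⊗β⊗γ⟩|² over all product states. Then t_{100} = t_{010} = t_{001} = 0. -/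
open scoped BigOperators ComplexConjugate

/-- If the vector `(1, 0)` maximizes the overlap with `(a, b)` among unit vectors of `ℂ²`,
then `b = 0`. -/
theorem eq_zero_of_normSq_overlap_le (a b : ℂ)
    (h : ∀ v : Fin 2 → ℂ, (∑ i : Fin 2, Complex.normSq (v i)) = 1 →
      Complex.normSq (conj (v 0) * a + conj (v 1) * b) ≤ Complex.normSq a) : b = 0 := by
  by_contra hb
  have hpos : 0 < Complex.normSq a + Complex.normSq b :=
    add_pos_of_nonneg_of_pos (Complex.normSq_nonneg a) (Complex.normSq_pos.mpr hb)
  obtain ⟨N, hN, hsq⟩ : ∃ N : ℝ, 0 < N ∧ N * N = Complex.normSq a + Complex.normSq b :=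
    ⟨√(Complex.normSq a + Complex.normSq b), Real.sqrt_pos.mpr hpos,
      Real.mul_self_sqrt hpos.le⟩
  have hNC : (N : ℂ) ≠ 0 := by exact_mod_cast hN.ne'
  have hunit : (∑ i : Fin 2, Complex.normSq ((![a / N, b / N] : Fin 2 → ℂ) i)) = 1 := by
    simp only [Fin.sum_univ_two, Matrix.cons_val_zero, Matrix.cons_val_one,
      Complex.normSq_div, Complex.normSq_ofReal]
    rw [← add_div, ← hsq]
    exact div_self (mul_pos hN hN).ne'
  have hval : conj (a / N) * a + conj (b / N) * b = (N : ℂ) := by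
    have hC : (N : ℂ) * N = conj a * a + conj b * b := by
      rw [← Complex.normSq_eq_conj_mul_self, ← Complex.normSq_eq_conj_mul_self]
      exact_mod_cast hsq
    rw [map_div₀, map_div₀, Complex.conj_ofReal]
    field_simp
    linear_combination -hC
  have hle := h _ hunit
  simp only [Matrix.cons_val_zero, Matrix.cons_val_one] at hle
  rw [hval, Complex.normSq_ofReal, hsq] at hle
  linarith [Complex.normSq_pos.mpr hb]

/-- Stationarity condition of the maximization decomposition: if the product
state `|000⟩` maximizes the squared overlap
`g(α,β,γ) = |⟨ψ, α⊗β⊗γ⟩|²` over all product states, then the coefficients of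
`ψ` with exactly one index flipped vanish.  Here `t i j k = ⟨ijk, ψ⟩` so that
`⟨α⊗β⊗γ, ψ⟩ = Σ conj(α i · β j · γ k) · t i j k`, and `|⟨ψ, α⊗β⊗γ⟩|²` equals
the squared norm of that sum. -/
theorem md_stationarity
    (t : Fin 2 → Fin 2 → Fin 2 → ℂ)
    (hnorm : ∑ i : Fin 2, ∑ j : Fin 2, ∑ k : Fin 2, Complex.normSq (t i j k) = 1)
    (hmax : ∀ α β γ : Fin 2 → ℂ,
      (∑ i : Fin 2, Complex.normSq (α i)) = 1 →
      (∑ j : Fin 2, Complex.normSq (β j)) = 1 →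
      (∑ k : Fin 2, Complex.normSq (γ k)) = 1 →
      Complex.normSq
        (∑ i : Fin 2, ∑ j : Fin 2, ∑ k : Fin 2, conj (α i * β j * γ k) * t i j k) ≤
        Complex.normSq (t 0 0 0)) :
    t 1 0 0 = 0 ∧ t 0 1 0 = 0 ∧ t 0 0 1 = 0 := by
  have he : (∑ i : Fin 2, Complex.normSq ((![1, 0] : Fin 2 → ℂ) i)) = 1 := by simp
  refine ⟨?_, ?_, ?_⟩ <;> refine eq_zero_of_normSq_overlap_le (t 0 0 0) _ fun v hv => ?_
  · simpa [Fin.sum_univ_two] using hmax v ![1, 0] ![1, 0] hv he he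
  · simpa [Fin.sum_univ_two] using hmax ![1, 0] v ![1, 0] he hv he
  · simpa [Fin.sum_univ_two] using hmax ![1, 0] ![1, 0] v he he hv
end

section
/- Let A be a nonzero n×n complex matrix such that for every positive semidefinite matrix ρ with trace 1 and A ρ A† ≠ 0, the matrix A ρ A† / tr(A ρ A†) has the same eigenvalues (with multiplicities) as ρ. Then A is a positive scalar multiple of a unitary matrix, i.e. there exist c > 0 and a unitary U with A = c·U. -/
open Matrix
open scoped ComplexOrder

/-- A Hermitian matrix with the spectrum of a real scalar matrix is that scalar matrix. -/
theorem Matrix.IsHermitian.eq_diagonal_const_of_charpoly_eq {ι : Type*} [Fintype ι]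
    [DecidableEq ι] {M : Matrix ι ι ℂ} (hM : M.IsHermitian) (r : ℝ)
    (h : M.charpoly = (diagonal fun _ : ι => (r : ℂ)).charpoly) :
    M = diagonal fun _ => (r : ℂ) := by
  have heig : ∀ i, hM.eigenvalues i = r := by
    intro i
    have hmem : (hM.eigenvalues i : ℂ) ∈ M.charpoly.roots := by
      rw [hM.roots_charpoly_eq_eigenvalues]
      exact Multiset.mem_map_of_mem (RCLike.ofReal ∘ hM.eigenvalues) (Finset.mem_univ_val i)
    have hroot := Polynomial.isRoot_of_mem_roots hmem
    rw [h, charpoly_diagonal, Polynomial.IsRoot, Polynomial.eval_prod] at hroot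
    obtain ⟨j, -, hj⟩ := Finset.prod_eq_zero_iff.mp hroot
    simp only [Polynomial.eval_sub, Polynomial.eval_X, Polynomial.eval_C, sub_eq_zero] at hj
    exact_mod_cast hj
  have hdiag : diagonal (RCLike.ofReal ∘ hM.eigenvalues) = (r : ℂ) • (1 : Matrix ι ι ℂ) := by
    rw [smul_one_eq_diagonal]
    congr 1
    funext i
    simp [heig i]
  rw [hM.spectral_theorem, hdiag, map_smul, map_one, smul_one_eq_diagonal]

/-- A nonzero Kraus operator that preserves the spectrum (eigenvalues with
multiplicities, i.e. the characteristic polynomial) of every normalized density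
matrix it acts on must be a positive multiple of a unitary. -/
theorem spectrum_preserving_kraus_is_scalar_unitary {n : ℕ}
    (A : Matrix (Fin n) (Fin n) ℂ) (hA : A ≠ 0)
    (hspec : ∀ ρ : Matrix (Fin n) (Fin n) ℂ, ρ.PosSemidef → ρ.trace = 1 →
      A * ρ * Aᴴ ≠ 0 →
      ((Matrix.trace (A * ρ * Aᴴ))⁻¹ • (A * ρ * Aᴴ)).charpoly = ρ.charpoly) :
    ∃ c : ℝ, 0 < c ∧ ∃ U ∈ Matrix.unitaryGroup (Fin n) ℂ, A = (c : ℂ) • U := by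
  have hn : (0 : ℝ) < n := by
    rcases Nat.eq_zero_or_pos n with rfl | h
    · exact absurd (Subsingleton.elim A 0) hA
    · exact_mod_cast h
  have hnC : (n : ℂ) ≠ 0 := by exact_mod_cast hn.ne'
  have hAA : A * Aᴴ ≠ 0 := fun h => hA (self_mul_conjTranspose_eq_zero.mp h)
  have hpos : (A * Aᴴ).PosSemidef := posSemidef_self_mul_conjTranspose A
  obtain ⟨t, ht⟩ : ∃ t : ℝ, (A * Aᴴ).trace = (t : ℂ) :=
    ⟨_, Complex.eq_re_of_ofReal_le (r := 0) (by simpa using hpos.trace_nonneg)⟩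
  have ht0 : 0 < t := by
    have h0 : (0 : ℂ) ≤ t := ht ▸ hpos.trace_nonneg
    have h1 : (t : ℂ) ≠ 0 := fun h => hAA (hpos.trace_eq_zero_iff.mp (ht.trans h))
    exact lt_of_le_of_ne (by exact_mod_cast h0) (by exact_mod_cast h1.symm)
  have htC : (t : ℂ) ≠ 0 := by exact_mod_cast ht0.ne'
  set ρ : Matrix (Fin n) (Fin n) ℂ := diagonal fun _ => (((n : ℝ)⁻¹ : ℝ) : ℂ) with hρ
  have hρ' : ρ = (n : ℂ)⁻¹ • 1 := by
    rw [hρ, smul_one_eq_diagonal]; simp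
  have hconj : A * ρ * Aᴴ = (n : ℂ)⁻¹ • (A * Aᴴ) := by
    rw [hρ', Matrix.mul_smul, Matrix.mul_one, Matrix.smul_mul]
  have hscaled : (Matrix.trace (A * ρ * Aᴴ))⁻¹ • (A * ρ * Aᴴ) = (t : ℂ)⁻¹ • (A * Aᴴ) := by
    rw [hconj, trace_smul, ht, smul_smul, smul_eq_mul]
    congr 1
    field_simp
  have hchar := hspec ρ
    (PosSemidef.diagonal fun _ => by
      simp only [Pi.zero_apply]
      exact_mod_cast (inv_pos.mpr hn).le)
    (by rw [hρ', trace_smul, trace_one, Fintype.card_fin, smul_eq_mul, inv_mul_cancel₀ hnC])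
    (by rw [hconj]; exact smul_ne_zero (inv_ne_zero hnC) hAA)
  rw [hscaled] at hchar
  have hherm : ((t : ℂ)⁻¹ • (A * Aᴴ)).IsHermitian := by
    rw [IsHermitian, conjTranspose_smul, hpos.isHermitian.eq]
    simp
  have hone : A * Aᴴ = ((t / n : ℝ) : ℂ) • 1 := by
    have h := hherm.eq_diagonal_const_of_charpoly_eq _ hchar
    rw [← hρ, hρ', inv_smul_eq_iff₀ htC, smul_smul] at h
    rw [h]
    push_cast
    rfl
  have hc : 0 < √(t / n) := Real.sqrt_pos.mpr (div_pos ht0 hn)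
  have hcC : ((√(t / n) : ℝ) : ℂ) ≠ 0 := by exact_mod_cast hc.ne'
  refine ⟨√(t / n), hc, ((√(t / n) : ℝ) : ℂ)⁻¹ • A, ?_, (smul_inv_smul₀ hcC A).symm⟩
  have hsq : ((t / n : ℝ) : ℂ) = (√(t / n) : ℝ) * (√(t / n) : ℝ) := by
    exact_mod_cast (Real.mul_self_sqrt (div_pos ht0 hn).le).symm
  rw [mem_unitaryGroup_iff, star_eq_conjTranspose, conjTranspose_smul, Matrix.smul_mul,
    Matrix.mul_smul, hone, smul_smul, smul_smul, hsq, star_inv₀, Complex.star_def,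
    Complex.conj_ofReal, mul_mul_mul_comm, inv_mul_cancel₀ hcC, one_mul, one_smul]
end
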